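/- Let K be a compact Hausdorff space of uncountable weight which contains a discrete subspace D with |D| = w(K). Then either K is finite dimensional, in which case basic(K) = cof([w(K)]^ℵ0, ⊆); or K is infinite dimensional, in which case basic(K) = |C(K)| = w(K)^ℵ0. -/

import Mathlib

open Cardinal Set Topology

noncomputable section

/-- A family `Φ ⊆ C(X)` is basic if every continuous real-valued function on `X`
is a finite sum of compositions `gᵢ ∘ φᵢ` with `φᵢ ∈ Φ` and `gᵢ ∈ C(ℝ)`. -/
def IsBasicFamily {X : Type u} [TopologicalSpace X] (Φ : Set C(X, ℝ)) : Prop :=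
  ∀ f : C(X, ℝ), ∃ (m : ℕ) (φ : Fin m → C(X, ℝ)) (g : Fin m → C(ℝ, ℝ)),
    (∀ i, φ i ∈ Φ) ∧ ∀ x, f x = ∑ i, g i (φ i x)

/-- `basic(X)`: the least cardinality of a basic family for `X`. -/
def basicCard (X : Type u) [TopologicalSpace X] : Cardinal.{u} :=
  sInf { c | ∃ Φ : Set C(X, ℝ), IsBasicFamily Φ ∧ #Φ = c }

/-- `dim X ≤ n`: every continuous map of a closed subspace of `X` into the
`n`-sphere extends continuously over `X`. -/
def DimLE (X : Type u) [TopologicalSpace X] (n : ℕ) : Prop :=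
  ∀ A : Set X, IsClosed A →
    ∀ f : C(A, Metric.sphere (0 : EuclideanSpace ℝ (Fin (n + 1))) 1),
      ∃ F : C(X, Metric.sphere (0 : EuclideanSpace ℝ (Fin (n + 1))) 1),
        ∀ a : A, F a = f a

/-- A Cantor set in `Y` is a subspace homeomorphic to the Cantor space `{0,1}^ℕ`. -/
def IsCantorSet {Y : Type u} [TopologicalSpace Y] (C : Set Y) : Prop :=
  Nonempty (C ≃ₜ (ℕ → Bool))

/-- Strong independence of a family `𝒞 ⊆ C(X)`. -/
def StronglyIndep {X : Type u} [TopologicalSpace X] (𝒞 : Set C(X, ℝ)) : Prop :=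
  ∀ (n : ℕ) (φ : C(X, Fin n → ℝ)),
    #(𝒞 ∩ { f : C(X, ℝ) | ∃ g : C((Fin n → ℝ), ℝ), ∀ x, f x = g (φ x) } : Set C(X, ℝ)) ≤ n

/-- Weak independence of a family `𝒞 ⊆ C(X)`. -/
def WeaklyIndep {X : Type u} [TopologicalSpace X] (𝒞 : Set C(X, ℝ)) : Prop :=
  ∀ (n : ℕ) (φ : Fin n → C(X, ℝ)),
    #(𝒞 ∩ { f : C(X, ℝ) | ∃ g : Fin n → C(ℝ, ℝ), ∀ x, f x = ∑ i, g i (φ i x) } : Set C(X, ℝ)) < 𝔠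

/-- The weight of a topological space: least cardinality of a basis. -/
def weightCard (X : Type u) [TopologicalSpace X] : Cardinal.{u} :=
  sInf { c | ∃ B : Set (Set X), TopologicalSpace.IsTopologicalBasis B ∧ #B = c }

/-- `cof([κ]^{ℵ₀}, ⊆)`: least cardinality of a family of countably infinite subsets
of (a set of size) `κ` which is cofinal in the countably infinite subsets. -/
def cofCtblSubsets (κ : Cardinal.{u}) : Cardinal.{u} :=
  sInf { c | ∃ 𝒞 : Set (Set κ.out),
    (∀ C ∈ 𝒞, C.Countable ∧ C.Infinite) ∧
    (∀ S : Set κ.out, S.Countable → S.Infinite → ∃ C ∈ 𝒞, S ⊆ C) ∧ #𝒞 = c }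

/-- Every `ι`-tuple of continuous functions on `X` can be uniformly approximated by tuples
without a common zero on `C`. -/
def ZeroFreeDenseOn {X : Type*} [TopologicalSpace X] (C : Set X) (ι : Type) : Prop :=
  ∀ (F : ι → C(X, ℝ)) (ε : ℝ), 0 < ε →
    ∃ G : ι → C(X, ℝ), (∀ i x, |G i x - F i x| < ε) ∧ ∀ x ∈ C, ∃ i, G i x ≠ 0

section Dimension

variable {X : Type*} [TopologicalSpace X]

theorem DimLE.zeroFreeDenseOn {n : ℕ} (h : DimLE X n) :
    ZeroFreeDenseOn (univ : Set X) (Fin (n + 1)) := by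
  intro F ε hε
  let E := EuclideanSpace ℝ (Fin (n + 1))
  let P : X → E := fun x => WithLp.toLp 2 (fun i => F i x)
  have hP : Continuous P := by
    refine (PiLp.continuous_toLp 2 _).comp ?_
    fun_prop
  set δ := ε / 3 with hδ
  have hδ0 : 0 < δ := by positivity
  have hA : IsClosed {x | ‖P x‖ = δ} := isClosed_eq hP.norm continuous_const
  let f : C({x | ‖P x‖ = δ}, Metric.sphere (0 : E) 1) :=
    ⟨fun a => ⟨δ⁻¹ • P a, by
      have : ‖P a‖ = δ := a.2
      rw [mem_sphere_zero_iff_norm, norm_smul, this, norm_inv, Real.norm_eq_abs, abs_of_pos hδ0,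
        inv_mul_cancel₀ hδ0.ne']⟩, by fun_prop⟩
  obtain ⟨H, hH⟩ := h _ hA f
  let Q : X → E := fun x => if ‖P x‖ ≤ δ then δ • (H x : E) else P x
  have hQ : Continuous Q := by
    refine Continuous.if_le ?_ hP hP.norm continuous_const ?_
    · fun_prop
    · intro x hx
      have := hH ⟨x, hx⟩
      rw [this]
      simp only [f, ContinuousMap.coe_mk, smul_smul, mul_inv_cancel₀ hδ0.ne', one_smul]
  have hnH : ∀ x, ‖(H x : E)‖ = 1 := fun x => mem_sphere_zero_iff_norm.1 (H x).2
  refine ⟨fun i => ⟨fun x => Q x i, ?_⟩, ?_, ?_⟩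
  · exact (continuous_apply i).comp ((PiLp.continuous_ofLp 2 _).comp hQ)
  · intro i x
    have h1 : ‖Q x - P x‖ < ε := by
      by_cases hx : ‖P x‖ ≤ δ
      · simp only [Q, if_pos hx]
        refine (norm_sub_le _ _).trans_lt ?_
        rw [norm_smul, hnH, Real.norm_eq_abs, abs_of_pos hδ0]
        linarith
      · simp only [Q, if_neg hx, sub_self, norm_zero, hε]
    have h2 := PiLp.norm_apply_le (Q x - P x) i
    exact lt_of_le_of_lt h2 h1
  · intro x _
    by_contra! hx
    have h0 : Q x = 0 := by
      ext i
      exact hx i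
    by_cases hx : ‖P x‖ ≤ δ
    · simp only [Q, if_pos hx] at h0
      have := congrArg norm h0
      rw [norm_smul, hnH, Real.norm_eq_abs, abs_of_pos hδ0, norm_zero] at this
      linarith
    · simp only [Q, if_neg hx] at h0
      rw [h0, norm_zero] at hx
      exact hx hδ0.le

theorem ZeroFreeDenseOn.dimLE [NormalSpace X] {n : ℕ}
    (h : ZeroFreeDenseOn (univ : Set X) (Fin (n + 1))) : DimLE X n := by
  intro A hA f
  let E := EuclideanSpace ℝ (Fin (n + 1))
  obtain ⟨p, hp⟩ := ContinuousMap.exists_restrict_eq hA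
    (⟨fun a i => (f a : E) i, by
      refine continuous_pi fun i => ?_
      exact (continuous_apply i).comp ((PiLp.continuous_ofLp 2 _).comp
        (continuous_subtype_val.comp f.continuous))⟩ : C(A, Fin (n + 1) → ℝ))
  obtain ⟨G, hG, hG0⟩ := h (fun i => ⟨fun x => p x i, by fun_prop⟩) (1 / (2 * (n + 1)))
    (by positivity)
  let P : X → E := fun x => WithLp.toLp 2 (p x)
  let R : X → E := fun x => WithLp.toLp 2 (fun i => G i x)
  have hP : Continuous P := (PiLp.continuous_toLp 2 _).comp p.continuous
  have hR : Continuous R := by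
    refine (PiLp.continuous_toLp 2 _).comp ?_
    fun_prop
  have hPA : ∀ a : A, P a = f a := by
    intro a
    have := DFunLike.congr_fun hp a
    ext i
    exact congrFun this i
  have hR0 : ∀ x, R x ≠ 0 := by
    intro x hx
    obtain ⟨i, hi⟩ := hG0 x trivial
    exact hi (congrArg (fun v : E => v i) hx)
  have hRP : ∀ x, ‖R x - P x‖ ≤ 1 / 2 := by
    intro x
    rw [EuclideanSpace.norm_eq]
    refine Real.sqrt_le_iff.2 ⟨by norm_num, ?_⟩
    have : ∀ i ∈ (Finset.univ : Finset (Fin (n + 1))), ‖(R x - P x) i‖ ^ 2 ≤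
        (1 / (2 * (n + 1) : ℝ)) ^ 2 := by
      intro i _
      have := (hG i x).le
      gcongr
      exact this
    refine (Finset.sum_le_card_nsmul _ _ _ this).trans ?_
    simp only [Finset.card_univ, Fintype.card_fin, nsmul_eq_mul]
    push_cast
    rw [div_pow, div_pow, ← mul_div_assoc, div_le_div_iff₀ (by positivity) (by positivity)]
    nlinarith [(Nat.cast_nonneg n : (0 : ℝ) ≤ n)]
  let u : X → ℝ := fun x => max 0 (min 1 (2 * ‖P x‖ - 1))
  have hu : Continuous u := by fun_prop
  have hu0 : ∀ x, 0 ≤ u x := fun x => le_max_left _ _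
  have hu1 : ∀ x, u x ≤ 1 := fun x => max_le zero_le_one (min_le_left _ _)
  let Q : X → E := fun x => P x + (1 - u x) • (R x - P x)
  have hQ : Continuous Q := by fun_prop
  have hQ0 : ∀ x, Q x ≠ 0 := by
    intro x hx
    by_cases hPx : ‖P x‖ ≤ 1 / 2
    · have : u x = 0 := by
        refine max_eq_left ((min_le_right _ _).trans ?_)
        linarith
      simp only [Q, this, sub_zero, one_smul, add_sub_cancel] at hx
      exact hR0 x hx
    · have h1 : P x = -((1 - u x) • (R x - P x)) := eq_neg_of_add_eq_zero_left hx
      have h2 := congrArg norm h1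
      rw [norm_neg, norm_smul, Real.norm_eq_abs, abs_of_nonneg (by linarith [hu1 x])] at h2
      have h3 := hRP x
      nlinarith [hu0 x, hu1 x, norm_nonneg (R x - P x)]
  refine ⟨⟨fun x => ⟨‖Q x‖⁻¹ • Q x, ?_⟩, ?_⟩, ?_⟩
  · rw [mem_sphere_zero_iff_norm, norm_smul, norm_inv, norm_norm,
      inv_mul_cancel₀ (norm_ne_zero_iff.2 (hQ0 x))]
  · refine Continuous.subtype_mk ?_ _
    exact (hQ.norm.inv₀ fun x => norm_ne_zero_iff.2 (hQ0 x)).smul hQ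
  · intro a
    have hn : ‖P a‖ = 1 := by
      rw [hPA]
      exact mem_sphere_zero_iff_norm.1 (f a).2
    have hua : u a = 1 := by
      simp only [u, hn]
      norm_num
    have hQa : Q a = P a := by simp [Q, hua]
    ext1
    change ‖Q a‖⁻¹ • Q a = _
    rw [hQa, hn, inv_one, one_smul, hPA]

theorem ZeroFreeDenseOn.exists_of_injective {C : Set X} {ι κ : Type}
    (h : ZeroFreeDenseOn C ι) {e : ι → κ} (he : Function.Injective e) (F : κ → C(X, ℝ)) {ε : ℝ}
    (hε : 0 < ε) : ∃ G : κ → C(X, ℝ), (∀ i x, |G i x - F i x| < ε) ∧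
      ∀ x ∈ C, ∃ i, G (e i) x ≠ 0 := by
  obtain ⟨G, hG, hG0⟩ := h (fun i => F (e i)) ε hε
  refine ⟨Function.extend e G F, fun i x => ?_, fun x hx => ?_⟩
  · by_cases hi : ∃ j, e j = i
    · obtain ⟨j, rfl⟩ := hi
      rw [he.extend_apply]
      exact hG j x
    · rw [Function.extend_apply' _ _ _ hi]
      simpa using hε
  · obtain ⟨i, hi⟩ := hG0 x hx
    exact ⟨i, by rwa [he.extend_apply]⟩

theorem ZeroFreeDenseOn.of_injective {C : Set X} {ι κ : Type}
    (h : ZeroFreeDenseOn C ι) {e : ι → κ} (he : Function.Injective e) : ZeroFreeDenseOn C κ := by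
  intro F ε hε
  obtain ⟨G, hG, hG0⟩ := h.exists_of_injective he F hε
  exact ⟨G, hG, fun x hx => ⟨_, (hG0 x hx).choose_spec⟩⟩

theorem ZeroFreeDenseOn.mono_nat {C : Set X} {m n : ℕ} (hmn : m ≤ n)
    (h : ZeroFreeDenseOn C (Fin m)) : ZeroFreeDenseOn C (Fin n) :=
  h.of_injective (Fin.castLE_injective hmn)

theorem ZeroFreeDenseOn.mono_set {C D : Set X} {ι : Type} (hCD : C ⊆ D)
    (h : ZeroFreeDenseOn D ι) : ZeroFreeDenseOn C ι := by
  intro F ε hε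
  obtain ⟨G, hG, hG0⟩ := h F ε hε
  exact ⟨G, hG, fun x hx => hG0 x (hCD hx)⟩

/-- If a tuple has no common zero on a compact set, it is bounded away from zero there. -/
theorem exists_pos_forall_exists_le {C : Set X} (hC : IsCompact C) {ι : Type} [Fintype ι]
    (F : ι → C(X, ℝ)) (h : ∀ x ∈ C, ∃ i, F i x ≠ 0) :
    ∃ δ > 0, ∀ x ∈ C, ∃ i, δ ≤ |F i x| := by
  rcases C.eq_empty_or_nonempty with rfl | hne
  · exact ⟨1, one_pos, by simp⟩
  obtain ⟨y, hy, hmin⟩ := hC.exists_isMinOn hne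
    (f := fun x => ∑ i, |F i x|) (by fun_prop)
  obtain ⟨j, hj⟩ := h y hy
  have hpos : 0 < ∑ i, |F i y| :=
    Finset.sum_pos' (fun i _ => abs_nonneg _) ⟨j, Finset.mem_univ _, abs_pos.2 hj⟩
  have hcard : (0 : ℝ) < Fintype.card ι := by
    exact_mod_cast Fintype.card_pos_iff.2 ⟨j⟩
  refine ⟨(∑ i, |F i y|) / Fintype.card ι, by positivity, fun x hx => ?_⟩
  by_contra! hlt
  have hx' : ∑ i, |F i y| ≤ ∑ i, |F i x| := hmin hx
  have : ∑ i, |F i x| < ∑ _i : ι, (∑ i, |F i y|) / Fintype.card ι :=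
    Finset.sum_lt_sum_of_nonempty ⟨j, Finset.mem_univ _⟩ fun i _ => hlt i
  rw [Finset.sum_const, nsmul_eq_mul, Finset.card_univ, mul_div_cancel₀ _ hcard.ne'] at this
  linarith

theorem ZeroFreeDenseOn.union {C D : Set X} (hC : IsCompact C) {ι : Type} [Fintype ι]
    (h₁ : ZeroFreeDenseOn C ι) (h₂ : ZeroFreeDenseOn D ι) : ZeroFreeDenseOn (C ∪ D) ι := by
  intro F ε hε
  obtain ⟨G, hG, hG0⟩ := h₁ F (ε / 2) (half_pos hε)
  obtain ⟨δ, hδ, hGδ⟩ := exists_pos_forall_exists_le hC G hG0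
  obtain ⟨H, hH, hH0⟩ := h₂ G (min (ε / 2) δ) (lt_min (half_pos hε) hδ)
  refine ⟨H, fun i x => ?_, ?_⟩
  · have h1 := hG i x
    have h2 := (hH i x).trans_le (min_le_left _ _)
    calc |H i x - F i x| ≤ |H i x - G i x| + |G i x - F i x| := abs_sub_le _ _ _
      _ < ε := by linarith
  · rintro x (hx | hx)
    · obtain ⟨i, hi⟩ := hGδ x hx
      refine ⟨i, fun h0 => ?_⟩
      have h2 := (hH i x).trans_le (min_le_right _ _)
      rw [h0, zero_sub, abs_neg] at h2
      linarith
    · exact hH0 x hx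

/-- Local form at a point: it suffices to control closed sets avoiding the point. -/
theorem ZeroFreeDenseOn.of_avoiding_point {N : Set X} (hN : IsCompact N) [T2Space X] {n : ℕ} (p : X)
    (h : ∀ C ⊆ N, IsClosed C → p ∉ C → ZeroFreeDenseOn C (Fin (n + 1))) :
    ZeroFreeDenseOn N (Fin (n + 1)) := by
  intro F ε hε
  have : ∃ c : ℝ, |c| < ε / 2 ∧ F 0 p + c ≠ 0 := by
    by_cases h0 : F 0 p = 0
    · exact ⟨ε / 4, by rw [abs_of_pos (by positivity)]; linarith, by rw [h0]; positivity⟩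
    · exact ⟨0, by simpa using hε, by simpa using h0⟩
  obtain ⟨c, hc, hc0⟩ := this
  let W : Set X := {x | |F 0 p + c| / 2 < |F 0 x + c|}
  have hW : IsOpen W := isOpen_lt continuous_const (by fun_prop)
  have hpos : 0 < |F 0 p + c| := abs_pos.2 hc0
  obtain ⟨G, hG, hG0⟩ := h (N \ W) sdiff_subset (hN.isClosed.sdiff hW)
    (fun hp => hp.2 (by simp only [W, mem_ofPred_eq]; linarith))
    (fun i => F i + ContinuousMap.const X c) (min (ε / 2) (|F 0 p + c| / 2))
    (lt_min (half_pos hε) (half_pos hpos))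
  refine ⟨G, fun i x => ?_, fun x hx => ?_⟩
  · have h1 := (hG i x).trans_le (min_le_left _ _)
    have h2 : G i x - F i x = (G i x - (F i + ContinuousMap.const X c) x) + c := by
      simp only [ContinuousMap.add_apply, ContinuousMap.const_apply]
      ring
    rw [h2]
    refine (abs_add_le _ _).trans_lt ?_
    linarith
  · by_cases hxW : x ∈ W
    · refine ⟨0, fun h0 => ?_⟩
      have h1 := (hG 0 x).trans_le (min_le_right _ _)
      rw [h0, zero_sub, abs_neg] at h1
      simp only [ContinuousMap.add_apply, ContinuousMap.const_apply] at h1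
      exact absurd hxW (not_lt.2 h1.le)
    · exact hG0 x ⟨hx, hxW⟩

end Dimension

section InfiniteDimension

/-- A continuous map `ℝᵐ → ℝᵐ⁺¹` can be uniformly approximated by maps omitting `0`. -/
theorem exists_zeroFree_approx {m : ℕ} (G : Fin (m + 1) → C(Fin m → ℝ, ℝ)) {ε : ℝ} (hε : 0 < ε) :
    ∃ P : Fin (m + 1) → C(Fin m → ℝ, ℝ),
      (∀ l y, |P l y - G l y| < ε) ∧ ∀ y, ∃ l, P l y ≠ 0 := by
  obtain ⟨g, hg, hgG, -⟩ := Continuous.exists_contDiff_approx (f := fun y l => G l y)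
    (ε := fun _ => ε / 2) 1 (by fun_prop) continuous_const (fun _ => half_pos hε)
  have hd : Dense (range g)ᶜ := ContDiff.dense_compl_range_of_finrank_lt_finrank hg (by simp)
  obtain ⟨c, hc, hcε⟩ := hd.exists_dist_lt 0 (half_pos hε)
  refine ⟨fun l => ⟨fun y => g y l - c l, ?_⟩, fun l y => ?_, fun y => ?_⟩
  · have := hg.continuous
    fun_prop
  · have h1 := (dist_pi_lt_iff (half_pos hε)).1 (hgG y) l
    have h2 := (dist_pi_lt_iff (half_pos hε)).1 hcε l
    rw [Real.dist_eq] at h1 h2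
    simp only [Pi.zero_apply, zero_sub, abs_neg] at h2
    calc |g y l - c l - G l y| = |(g y l - G l y) - c l| := by ring_nf
      _ ≤ |g y l - G l y| + |c l| := abs_sub _ _
      _ < ε := by linarith
  · by_contra! h
    refine hc ⟨y, funext fun l => ?_⟩
    have := h l
    simp only [ContinuousMap.coe_mk] at this
    linarith

variable {X : Type*} [TopologicalSpace X] [CompactSpace X] [T2Space X]

theorem exists_point_forall_not_zeroFreeDenseOn
    (h : ∀ n : ℕ, ¬ ZeroFreeDenseOn (univ : Set X) (Fin n)) :
    ∃ p : X, ∀ n : ℕ, ∀ U ∈ 𝓝 p, ∃ C ⊆ U, IsClosed C ∧ p ∉ C ∧ ¬ ZeroFreeDenseOn C (Fin n) := by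
  by_contra! hp
  have key : ∃ n : ℕ, ZeroFreeDenseOn (closure (univ : Set X)) (Fin n) := by
    refine isCompact_univ.induction_on (p := fun s => ∃ n : ℕ, ZeroFreeDenseOn (closure s) (Fin n))
      ⟨0, ?_⟩ ?_ ?_ ?_
    · intro F ε hε
      exact ⟨F, by simp [hε], by simp⟩
    · rintro s t hst ⟨n, hn⟩
      exact ⟨n, hn.mono_set (closure_mono hst)⟩
    · rintro s t ⟨n, hn⟩ ⟨m, hm⟩
      refine ⟨max n m, ?_⟩
      rw [closure_union]
      exact (hn.mono_nat (le_max_left _ _)).union isClosed_closure.isCompact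
        (hm.mono_nat (le_max_right _ _))
    · intro x _
      obtain ⟨n, U, hU, hn⟩ := hp x
      obtain ⟨t, ht, htc, htU⟩ := exists_mem_nhds_isClosed_subset hU
      refine ⟨t, mem_nhdsWithin_of_mem_nhds ht, n + 1, ?_⟩
      rw [htc.closure_eq]
      exact ZeroFreeDenseOn.of_avoiding_point htc.isCompact x fun C hC hCc hxC =>
        (hn C (hC.trans htU) hCc hxC).mono_nat n.le_succ
  obtain ⟨n, hn⟩ := key
  rw [closure_univ] at hn
  exact h n hn

/-- An infinite dimensional space contains a sequence of closed sets of growing dimension which are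
separated from each other by bump functions. -/
theorem exists_seq_not_zeroFreeDenseOn
    (h : ∀ n : ℕ, ¬ ZeroFreeDenseOn (univ : Set X) (Fin n)) :
    ∃ (C : ℕ → Set X) (u : ℕ → C(X, ℝ)),
      (∀ k, ¬ ZeroFreeDenseOn (C k) (Fin k → Bool)) ∧
      (∀ k, ∀ x ∈ C k, u k x = 1) ∧ (∀ j k, j ≠ k → ∀ x ∈ C j, u k x = 0) ∧
      ∀ k x, |u k x| ≤ 1 := by
  obtain ⟨p, hp⟩ := exists_point_forall_not_zeroFreeDenseOn h
  have step : ∀ (k : ℕ) (U : {U : Set X // U ∈ 𝓝 p}),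
      ∃ (C : Set X) (V : {U : Set X // U ∈ 𝓝 p}), IsClosed C ∧ C ⊆ interior U.1 ∧
        ¬ ZeroFreeDenseOn C (Fin k → Bool) ∧ closure V.1 ⊆ interior U.1 ∧
        Disjoint (closure V.1) C := by
    rintro k ⟨U, hU⟩
    obtain ⟨C, hCU, hC, hpC, hCn⟩ := hp (Fintype.card (Fin k → Bool)) _ (interior_mem_nhds.2 hU)
    obtain ⟨V, hV, hVc, hVU⟩ := exists_mem_nhds_isClosed_subset
      (Filter.inter_mem (interior_mem_nhds.2 hU) (hC.isOpen_compl.mem_nhds hpC))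
    refine ⟨C, ⟨V, hV⟩, hC, hCU, fun hZ => hCn (hZ.of_injective (Fintype.equivFin _).injective),
      ?_, ?_⟩
    · rw [hVc.closure_eq]
      exact hVU.trans inter_subset_left
    · rw [hVc.closure_eq]
      exact disjoint_left.2 fun x hx => (hVU hx).2
  choose Cf Vf hC hCU hCn hVU hVC using step
  let U : ℕ → {U : Set X // U ∈ 𝓝 p} := fun n => Nat.rec ⟨univ, Filter.univ_mem⟩ Vf n
  have hU : ∀ k, U (k + 1) = Vf k (U k) := fun k => rfl
  have hanti : Antitone fun k => (U k).1 := antitone_nat_of_succ_le fun k => by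
    rw [hU]
    exact subset_closure.trans ((hVU k (U k)).trans interior_subset)
  have hu : ∀ k, ∃ u : C(X, ℝ),
      EqOn u 0 ((interior (U k).1)ᶜ ∪ closure (U (k + 1)).1) ∧ EqOn u 1 (Cf k (U k)) ∧
      ∀ x, u x ∈ Icc (0 : ℝ) 1 := by
    intro k
    refine exists_continuous_zero_one_of_isClosed
      (isOpen_interior.isClosed_compl.union isClosed_closure) (hC k _) ?_
    rw [disjoint_union_left]
    exact ⟨disjoint_compl_left_iff_subset.2 (hCU k _), hVC k _⟩
  choose u hu0 hu1 huI using hu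
  refine ⟨fun k => Cf k (U k), u, fun k => hCn k _, fun k x hx => hu1 k hx, ?_, fun k x => ?_⟩
  · intro j k hjk x hx
    refine hu0 k ?_
    rcases lt_or_gt_of_ne hjk with hlt | hgt
    · left
      intro hxk
      have h1 : x ∈ (U (j + 1)).1 := hanti (Nat.succ_le_of_lt hlt) (interior_subset hxk)
      exact disjoint_left.1 (hVC j (U j)) (subset_closure h1) hx
    · right
      exact subset_closure (hanti (Nat.succ_le_of_lt hgt) (interior_subset (hCU j _ hx)))
  · rw [abs_of_nonneg (huI k x).1]
    exact (huI k x).2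

/-- An infinite dimensional compact space carries a family of continuous functions indexed by
the Cantor set such that `m` functions never determine more than `m` of them. -/
theorem exists_stronglyIndep_family (h : ∀ n : ℕ, ¬ ZeroFreeDenseOn (univ : Set X) (Fin n)) :
    ∃ f : (ℕ → Bool) → C(X, ℝ), ∀ (m : ℕ) (φ : Fin m → C(X, ℝ)) (α : Fin (m + 1) → (ℕ → Bool)),
      Function.Injective α →
      ¬ ∃ G : Fin (m + 1) → C(Fin m → ℝ, ℝ), ∀ l x, f (α l) x = G l (fun i => φ i x) := by
  obtain ⟨C, u, hC, hu1, hu0, hu⟩ := exists_seq_not_zeroFreeDenseOn h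
  simp only [ZeroFreeDenseOn, not_forall] at hC
  choose F ε hε hF using hC
  let c : ℕ → ℝ := fun k => (1 / 2) ^ k / (1 + ∑ σ, ‖F k σ‖)
  have hS : ∀ k, 0 ≤ ∑ σ, ‖F k σ‖ := fun k => Finset.sum_nonneg fun _ _ => norm_nonneg _
  have hc : ∀ k, 0 < c k := fun k => div_pos (by positivity) (by linarith [hS k])
  let t : (ℕ → Bool) → ℕ → C(X, ℝ) := fun α k => c k • (u k * F k (fun i => α i))
  have ht : ∀ α k, ‖t α k‖ ≤ (1 / 2 : ℝ) ^ k := by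
    intro α k
    refine (ContinuousMap.norm_le _ (by positivity)).2 fun x => ?_
    have h1 : ‖F k (fun i => α i) x‖ ≤ 1 + ∑ σ, ‖F k σ‖ :=
      ((F k _).norm_coe_le_norm x).trans <| (Finset.single_le_sum
        (f := fun σ => ‖F k σ‖) (fun _ _ => norm_nonneg _) (Finset.mem_univ _)).trans (by linarith)
    have h2 : ‖u k x‖ ≤ 1 := hu k x
    have h3 : (0 : ℝ) < 1 + ∑ σ, ‖F k σ‖ := by linarith [hS k]
    simp only [t, ContinuousMap.smul_apply, ContinuousMap.mul_apply, norm_smul, norm_mul,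
      Real.norm_of_nonneg (hc k).le]
    calc c k * (‖u k x‖ * ‖F k (fun i => α i) x‖) ≤ c k * (1 * (1 + ∑ σ, ‖F k σ‖)) := by
          have := (hc k).le
          gcongr
      _ = (1 / 2) ^ k := by
          simp only [c, one_mul]
          field_simp
  have hsum : ∀ α, Summable (t α) := fun α =>
    Summable.of_norm_bounded (summable_geometric_of_lt_one (by norm_num) (by norm_num)) (ht α)
  let f : (ℕ → Bool) → C(X, ℝ) := fun α => ∑' k, t α k
  have hf : ∀ α k, ∀ x ∈ C k, f α x = c k * F k (fun i => α i) x := by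
    intro α k x hx
    simp only [f]
    rw [← ContinuousMap.tsum_apply (hsum α), tsum_eq_single k]
    · simp [t, hu1 k x hx]
    · intro j hj
      simp [t, hu0 k j hj.symm x hx]
  refine ⟨f, ?_⟩
  rintro m φ α hα ⟨G, hG⟩
  have hsep : ∃ k : ℕ, Function.Injective fun (l : Fin (m + 1)) (i : Fin k) => α l i := by
    have h1 : ∀ p : Fin (m + 1) × Fin (m + 1), ∃ k : ℕ, p.1 ≠ p.2 → α p.1 k ≠ α p.2 k := by
      intro p
      by_cases hp : p.1 = p.2
      · exact ⟨0, fun h => absurd hp h⟩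
      · obtain ⟨k, hk⟩ := Function.ne_iff.1 (hα.ne hp)
        exact ⟨k, fun _ => hk⟩
    choose κ hκ using h1
    refine ⟨Finset.univ.sup κ + 1, fun l l' hll => ?_⟩
    by_contra hne
    refine hκ (l, l') hne ?_
    exact congrFun hll ⟨κ (l, l'), Nat.lt_succ_of_le (Finset.le_sup (Finset.mem_univ _))⟩
  obtain ⟨k, hk⟩ := hsep
  obtain ⟨P, hP, hP0⟩ := exists_zeroFree_approx G (mul_pos (hc k) (hε k))
  let e : Fin (m + 1) → (Fin k → Bool) := fun l i => α l i
  let Q : Fin (m + 1) → C(X, ℝ) := fun l =>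
    F k (e l) + (c k)⁻¹ • (⟨fun x => P l (fun i => φ i x), by fun_prop⟩ - f (α l))
  refine hF k ⟨Function.extend e Q (F k), fun σ x => ?_, fun x hx => ?_⟩
  · by_cases hσ : ∃ l, e l = σ
    · obtain ⟨l, rfl⟩ := hσ
      rw [hk.extend_apply]
      have h1 := hP l (fun i => φ i x)
      rw [← hG l x] at h1
      simp only [Q, ContinuousMap.add_apply, ContinuousMap.smul_apply, ContinuousMap.sub_apply,
        ContinuousMap.coe_mk, add_sub_cancel_left, smul_eq_mul, abs_mul, abs_inv,
        abs_of_pos (hc k)]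
      rwa [inv_mul_lt_iff₀ (hc k)]
    · rw [Function.extend_apply' _ _ _ hσ]
      simpa using hε k
  · obtain ⟨l, hl⟩ := hP0 (fun i => φ i x)
    refine ⟨e l, ?_⟩
    rw [hk.extend_apply]
    have h1 : Q l x = (c k)⁻¹ * P l (fun i => φ i x) := by
      simp only [Q, ContinuousMap.add_apply, ContinuousMap.smul_apply, ContinuousMap.sub_apply,
        ContinuousMap.coe_mk, smul_eq_mul, hf (α l) k x hx, mul_sub, e]
      rw [inv_mul_cancel_left₀ (hc k).ne']
      ring
    rw [h1]
    exact mul_ne_zero (inv_ne_zero (hc k).ne') hl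

end InfiniteDimension

theorem continuum_le_of_isBasicFamily {X : Type u} [TopologicalSpace X] [CompactSpace X]
    [T2Space X] (h : ∀ n : ℕ, ¬ DimLE X n) {Φ : Set C(X, ℝ)} (hΦ : IsBasicFamily Φ) :
    𝔠 ≤ #Φ := by
  obtain ⟨f, hf⟩ := exists_stronglyIndep_family (X := X) fun n hn =>
    h n (hn.mono_nat n.le_succ).dimLE
  choose m φ g hφ hg using fun α => hΦ (f α)
  let T := Σ n, Fin n → Φ
  let code : (ℕ → Bool) → T := fun α => ⟨m α, fun i => ⟨φ α i, hφ α i⟩⟩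
  have hfib : ∀ b : T, (code ⁻¹' {b}).Finite := by
    rintro ⟨n, ψ⟩
    by_contra hinf
    obtain ⟨s, hs, hcard⟩ := Set.Infinite.exists_subset_card_eq hinf (n + 1)
    refine hf n (fun i => ψ i) (fun l => (s.equivFinOfCardEq hcard).symm l)
      (Subtype.val_injective.comp (Equiv.injective _)) ?_
    have : ∀ α : s, ∃ G : C(Fin n → ℝ, ℝ), ∀ x, f α x = G (fun i => (ψ i : C(X, ℝ)) x) := by
      rintro ⟨α, hα⟩
      have hcode : code α = ⟨n, ψ⟩ := hs hα
      obtain ⟨rfl, hψ⟩ := Sigma.mk.inj_iff.1 hcode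
      obtain rfl := eq_of_heq hψ
      exact ⟨⟨fun y => ∑ i, g α i (y i), by fun_prop⟩, fun x => hg α x⟩
    choose G hG using this
    exact ⟨fun l => G _, fun l x => hG _ x⟩
  have h1 : Cardinal.lift.{u} #(ℕ → Bool) ≤ Cardinal.lift.{0} #T * ℵ₀ :=
    Cardinal.lift_mk_le_lift_mk_mul_of_lift_mk_preimage_le code fun b => by
      rw [Cardinal.lift_le_aleph0]
      exact (hfib b).countable.le_aleph0
  have h2 : #T ≤ max ℵ₀ #Φ := (Cardinal.mk_congr List.equivSigmaTuple).symm.trans_le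
    (Cardinal.mk_list_le_max Φ)
  have h3 : 𝔠 ≤ max ℵ₀ #Φ := by
    have h4 : Cardinal.lift.{u} #(ℕ → Bool) = 𝔠 := by simp
    rw [h4, Cardinal.lift_uzero] at h1
    refine h1.trans ((mul_le_mul_left h2 _).trans ?_)
    rw [Cardinal.mul_eq_left (le_max_left _ _) (le_max_left _ _) aleph0_ne_zero]
  rcases le_max_iff.1 h3 with h4 | h4
  · exact absurd h4 (not_le.2 Cardinal.aleph0_lt_continuum)
  · exact h4

section Coloring

theorem exists_pos_forall_le_of_finite {T : Type*} [Finite T] (p : T → ℝ) (hp : ∀ t, 0 < p t) :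
    ∃ δ > 0, ∀ t, δ ≤ p t := by
  rcases isEmpty_or_nonempty T with hT | hT
  · exact ⟨1, one_pos, fun t => isEmptyElim t⟩
  · obtain ⟨t, ht⟩ := Finite.exists_min p
    exact ⟨p t, hp t, ht⟩

/-- Finitely many real numbers can be made distinct by an arbitrarily small perturbation. -/
theorem exists_injective_approx {L : Type*} [Finite L] (a : L → ℝ) {η : ℝ} (hη : 0 < η) :
    ∃ c : L → ℝ, Function.Injective c ∧ ∀ l, |c l - a l| ≤ η := by
  obtain ⟨M, ⟨e⟩⟩ := Finite.exists_equiv_fin L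
  have hM : (0 : ℝ) < M + 1 := by positivity
  obtain ⟨t, ht, htn⟩ := ((Ioo_infinite (div_pos hη hM)).sdiff
    (finite_range fun p : L × L => (a p.1 - a p.2) / ((e p.2 : ℝ) - (e p.1 : ℝ)))).nonempty
  refine ⟨fun l => a l + t * (e l : ℝ), fun l l' hll => ?_, fun l => ?_⟩
  · by_contra hne
    have hee : ((e l' : ℕ) : ℝ) - (e l : ℕ) ≠ 0 := by
      rw [sub_ne_zero]
      intro h
      exact hne (e.injective (Fin.ext (by exact_mod_cast h.symm)))
    refine htn ⟨(l, l'), ?_⟩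
    simp only at hll ⊢
    rw [div_eq_iff hee]
    linarith
  · have h1 : ((e l : ℕ) : ℝ) ≤ M := by exact_mod_cast (e l).2.le
    have h0 : (0 : ℝ) ≤ ((e l : ℕ) : ℝ) := Nat.cast_nonneg _
    rw [add_sub_cancel_left, abs_of_nonneg (mul_nonneg ht.1.le h0)]
    have h2 : t * (M + 1) < η := (lt_div_iff₀ hM).1 ht.2
    nlinarith [ht.1]

variable {X : Type*} [TopologicalSpace X] [CompactSpace X]

/-- General position: after a small perturbation, at every point at most `n` of the `N` translates
of the integer lattice are hit by some coordinate. -/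
theorem ZeroFreeDenseOn.exists_generalPosition {n : ℕ}
    (h : ZeroFreeDenseOn (univ : Set X) (Fin (n + 1))) (N : ℕ) {ι : Type} [Fintype ι]
    (f : ι → C(X, ℝ)) :
    ∃ g : ι → C(X, ℝ), (∀ i x, |g i x - f i x| < 1) ∧
      ∀ x, {j : Fin N | ∃ i, ∃ z : ℤ, g i x = z + (j : ℝ) / N}.ncard ≤ n := by
  let T := {p : (Fin (n + 1) → ι) × (Fin (n + 1) → Fin N) × (Fin (n + 1) → ℤ) //
    Function.Injective p.1}
  let r : T → Fin (n + 1) → ℝ := fun p l => p.1.2.2 l + (p.1.2.1 l : ℝ) / N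
  let O : T → Set (ι → C(X, ℝ)) := fun p => {F | ∀ x, ∃ l, F (p.1.1 l) x ≠ r p l}
  have hO : ∀ p, IsOpen (O p) := by
    intro p
    rw [Metric.isOpen_iff]
    intro F hF
    obtain ⟨δ, hδ, hFδ⟩ := exists_pos_forall_exists_le isCompact_univ
      (fun l => F (p.1.1 l) - ContinuousMap.const X (r p l))
      (fun x _ => (hF x).imp fun l hl => by simpa [sub_eq_zero] using hl)
    refine ⟨δ, hδ, fun F' hF' x => ?_⟩
    obtain ⟨l, hl⟩ := hFδ x trivial
    refine ⟨l, fun h0 => ?_⟩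
    have h1 : dist (F' (p.1.1 l) x) (F (p.1.1 l) x) < δ :=
      (ContinuousMap.dist_apply_le_dist x).trans_lt ((dist_le_pi_dist F' F _).trans_lt hF')
    rw [h0, Real.dist_eq, abs_sub_comm] at h1
    simp only [ContinuousMap.sub_apply, ContinuousMap.const_apply] at hl
    linarith
  have hd : ∀ p, Dense (O p) := by
    intro p
    rw [Metric.dense_iff]
    intro F ε hε
    obtain ⟨G, hG, hG0⟩ := h.exists_of_injective p.2
      (fun i => F i - ContinuousMap.const X (Function.extend p.1.1 (r p) 0 i)) (half_pos hε)
    refine ⟨fun i => G i + ContinuousMap.const X (Function.extend p.1.1 (r p) 0 i), ?_, ?_⟩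
    · rw [Metric.mem_ball]
      refine lt_of_le_of_lt ((dist_pi_le_iff (half_pos hε).le).2 fun i => ?_) (half_lt_self hε)
      refine (ContinuousMap.dist_le (half_pos hε).le).2 fun x => ?_
      rw [Real.dist_eq]
      have := (hG i x).le
      simp only [ContinuousMap.sub_apply, ContinuousMap.add_apply,
        ContinuousMap.const_apply] at this ⊢
      rwa [sub_sub_eq_add_sub] at this
    · intro x
      obtain ⟨l, hl⟩ := hG0 x trivial
      refine ⟨l, ?_⟩
      simp only [ContinuousMap.add_apply, ContinuousMap.const_apply, p.2.extend_apply]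
      simpa using hl
  have hdense := dense_iInter_of_isOpen hO hd
  obtain ⟨g, hg, hgf⟩ := hdense.exists_dist_lt f one_pos
  rw [mem_iInter] at hg
  refine ⟨g, fun i x => ?_, fun x => ?_⟩
  · rw [← Real.dist_eq, dist_comm]
    exact (ContinuousMap.dist_apply_le_dist x).trans_lt ((dist_le_pi_dist f g _).trans_lt hgf)
  · by_contra! hcard
    obtain ⟨s, hs, hsc⟩ := Set.exists_subset_card_eq (Nat.succ_le_of_lt hcard)
    obtain ⟨e⟩ : Nonempty (Fin (n + 1) ≃ s) :=
      ⟨(Finite.equivFinOfCardEq (by rw [Nat.card_coe_set_eq, hsc])).symm⟩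
    have he : ∀ l, ∃ i, ∃ z : ℤ, g i x = z + ((e l : Fin N) : ℝ) / N := fun l => hs (e l).2
    choose i z hiz using he
    have hi : Function.Injective i := by
      intro l l' hll
      have h1 := hiz l
      rw [hll, hiz l'] at h1
      have hN : (0 : ℝ) < N := by exact_mod_cast (Fin.pos (e l : Fin N))
      have hfr : ∀ l, Int.fract ((z l : ℝ) + ((e l : Fin N) : ℝ) / N) =
          ((e l : Fin N) : ℝ) / N := by
        intro l
        rw [Int.fract_intCast_add, Int.fract_eq_self]
        refine ⟨by positivity, (div_lt_one hN).2 ?_⟩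
        exact_mod_cast (e l : Fin N).2
      have h2 := hfr l
      rw [← h1, hfr l', div_left_inj' hN.ne'] at h2
      exact e.injective (Subtype.ext (Fin.ext (by exact_mod_cast h2.symm)))
    obtain ⟨l, hl⟩ := hg ⟨(i, fun l => e l, z), hi⟩ x
    exact hl (hiz l)

/-- Colored families of closed sets on which every coordinate has small oscillation; every point
is covered by all but at most `n` of the colors. -/
theorem ZeroFreeDenseOn.exists_coloring {n : ℕ}
    (h : ZeroFreeDenseOn (univ : Set X) (Fin (n + 1))) (N : ℕ) {ι : Type} [Fintype ι]
    (f : ι → C(X, ℝ)) :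
    ∃ (G : Fin N → Set X) (cell : ∀ j, G j → ι → ℤ), (∀ j, IsClosed (G j)) ∧
      (∀ x, {j | x ∉ G j}.ncard ≤ n) ∧ (∀ j, IsLocallyConstant (cell j)) ∧
      ∀ j (x y : G j), cell j x = cell j y → ∀ i, |f i x - f i y| < 3 := by
  obtain ⟨g, hgf, hg⟩ := h.exists_generalPosition N f
  let b : Fin N → C(X, ℝ) := fun j =>
    ⟨fun x => ∏ i, |Real.sin (Real.pi * (g i x - (j : ℝ) / N))|, by fun_prop⟩
  have hb : ∀ j x, b j x = 0 → ∃ i, ∃ z : ℤ, g i x = z + (j : ℝ) / N := by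
    intro j x h0
    obtain ⟨i, -, hi⟩ := Finset.prod_eq_zero_iff.1 h0
    rw [abs_eq_zero, Real.sin_eq_zero_iff] at hi
    obtain ⟨z, hz⟩ := hi
    refine ⟨i, z, ?_⟩
    rw [mul_comm] at hz
    have := mul_left_cancel₀ Real.pi_ne_zero hz
    linarith
  have hb0 : ∀ j x, 0 ≤ b j x := fun j x => Finset.prod_nonneg fun _ _ => abs_nonneg _
  have hJ : ∀ J : {J : Set (Fin N) // J.ncard = n + 1}, ∃ δ > 0, ∀ x, ∃ j ∈ J.1, δ ≤ b j x := by
    classical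
    rintro ⟨J, hJ⟩
    obtain ⟨δ, hδ, hδb⟩ := exists_pos_forall_exists_le (X := X) isCompact_univ
      (fun j : J => b j) (fun x _ => by
        by_contra! h0
        have hsub : J ⊆ {j : Fin N | ∃ i, ∃ z : ℤ, g i x = z + (j : ℝ) / N} :=
          fun j hj => hb j x (h0 ⟨j, hj⟩)
        have h1 := Set.ncard_le_ncard hsub (Set.toFinite _)
        have h2 := hg x
        omega)
    refine ⟨δ, hδ, fun x => ?_⟩
    obtain ⟨j, hj⟩ := hδb x trivial
    exact ⟨j, j.2, by rwa [abs_of_nonneg (hb0 _ _)] at hj⟩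
  choose δ hδ hδb using hJ
  obtain ⟨τ, hτ, hτδ⟩ := exists_pos_forall_le_of_finite δ hδ
  refine ⟨fun j => {x | τ ≤ b j x}, fun j x i => ⌊g i x - (j : ℝ) / N⌋, fun j => ?_, fun x => ?_,
    fun j => ?_, fun j x y hxy i => ?_⟩
  · exact isClosed_le continuous_const (b j).continuous
  · by_contra! hcard
    obtain ⟨s, hs, hsc⟩ := Set.exists_subset_card_eq (Nat.succ_le_of_lt hcard)
    obtain ⟨j, hj, hjx⟩ := hδb ⟨s, hsc⟩ x
    exact hs hj ((hτδ _).trans hjx)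
  · rw [IsLocallyConstant.iff_eventually_eq]
    intro x
    have hx : ∀ i, ∀ᶠ y : {x | τ ≤ b j x} in 𝓝 x,
        ⌊g i y - (j : ℝ) / N⌋ = ⌊g i x - (j : ℝ) / N⌋ := by
      intro i
      have hne : (⌊g i x - (j : ℝ) / N⌋ : ℝ) ≠ g i x - (j : ℝ) / N := by
        intro h0
        have h1 : b j x = 0 := by
          refine Finset.prod_eq_zero (Finset.mem_univ i) ?_
          rw [← h0, mul_comm, Real.sin_int_mul_pi, abs_zero]
        have h2 : τ ≤ b j x := x.2
        linarith
      have hmem : Ioo (⌊g i x - (j : ℝ) / N⌋ : ℝ) (⌊g i x - (j : ℝ) / N⌋ + 1) ∈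
          𝓝 (g i x - (j : ℝ) / N) :=
        Ioo_mem_nhds ((Int.floor_le _).lt_of_ne hne) (Int.lt_floor_add_one _)
      have hcont : Continuous fun y : {x | τ ≤ b j x} => g i y - (j : ℝ) / N := by fun_prop
      filter_upwards [hcont.continuousAt.preimage_mem_nhds hmem] with y hy
      exact Int.floor_eq_iff.2 ⟨hy.1.le, hy.2⟩
    filter_upwards [Filter.eventually_all.2 hx] with y hy
    exact funext hy
  · have h1 := Int.abs_sub_lt_one_of_floor_eq_floor (congrFun hxy i)
    have h2 := hgf i x
    have h3 := hgf i y
    rw [abs_lt] at *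
    constructor <;> linarith

end Coloring

section Superposition

variable {X : Type*} [TopologicalSpace X]

/-- Every point lies in all but at most `n` of the sets `G j`; on each `G j`, points at which `φ j`
takes nearby values are not `ε`-separated by `E 0, …, E k` or by any of the functions `φ`. -/
def SeparatesUpTo {N : ℕ} (E : ℕ → C(X, ℝ)) (φ : Fin N → C(X, ℝ)) (n k : ℕ) (ε : ℝ) : Prop :=
  ∃ G : Fin N → Set X, ∃ δ > 0, (∀ x, {j | x ∉ G j}.ncard ≤ n) ∧
    ∀ j, ∀ x ∈ G j, ∀ y ∈ G j, |φ j x - φ j y| < δ →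
      (∀ i ≤ k, |E i x - E i y| < ε) ∧ ∀ j', |φ j' x - φ j' y| < ε

theorem SeparatesUpTo.exists_forall_dist_le {N n k : ℕ} {E : ℕ → C(X, ℝ)} {φ : Fin N → C(X, ℝ)}
    {ε : ℝ} (hε : 0 < ε) (h : SeparatesUpTo E φ n k ε) :
    ∃ ρ > 0, ∀ ψ : Fin N → C(X, ℝ), (∀ j x, |ψ j x - φ j x| ≤ ρ) →
      SeparatesUpTo E ψ n k (2 * ε) := by
  obtain ⟨G, δ, hδ, hG, hs⟩ := h
  refine ⟨min (δ / 4) (ε / 4), by positivity, fun ψ hψ =>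
    ⟨G, δ / 2, half_pos hδ, hG, fun j x hx y hy hxy => ?_⟩⟩
  have hρ₁ := min_le_left (δ / 4) (ε / 4)
  have hρ₂ := min_le_right (δ / 4) (ε / 4)
  have key : |φ j x - φ j y| < δ := by
    have h1 := abs_le.1 (hψ j x)
    have h2 := abs_le.1 (hψ j y)
    rw [abs_lt] at hxy ⊢
    constructor <;> linarith
  obtain ⟨h1, h2⟩ := hs j x hx y hy key
  refine ⟨fun i hi => (h1 i hi).trans (by linarith), fun j' => ?_⟩
  have h3 := abs_le.1 (hψ j' x)
  have h4 := abs_le.1 (hψ j' y)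
  have h5 := abs_lt.1 (h2 j')
  rw [abs_lt]
  constructor <;> linarith

variable [CompactSpace X]

theorem ZeroFreeDenseOn.exists_separatesUpTo [NormalSpace X] {n : ℕ}
    (h : ZeroFreeDenseOn (univ : Set X) (Fin (n + 1))) {N : ℕ} (E : ℕ → C(X, ℝ))
    (φ : Fin N → C(X, ℝ)) (k : ℕ) {η ε : ℝ} (hη : 0 < η) (hε : 0 < ε) :
    ∃ ψ : Fin N → C(X, ℝ), (∀ j x, |ψ j x - φ j x| ≤ η) ∧ SeparatesUpTo E ψ n k ε := by
  wlog hηε : η ≤ ε / 4 generalizing η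
  · obtain ⟨ψ, hψ, hs⟩ := this (η := ε / 4) (by positivity) le_rfl
    exact ⟨ψ, fun j x => (hψ j x).trans (not_le.1 hηε).le, hs⟩
  obtain ⟨G, cell, hGc, hGn, hloc, hcell⟩ := h.exists_coloring N
    (Sum.elim (fun i : Fin (k + 1) => (8 / η) • E i) (fun j : Fin N => (8 / η) • φ j))
  have hscale : ∀ (f : C(X, ℝ)) (x y : X), |((8 / η) • f) x - ((8 / η) • f) y| < 3 →
      |f x - f y| < 3 / 8 * η := by
    intro f x y hf
    simp only [ContinuousMap.smul_apply, smul_eq_mul, ← mul_sub, abs_mul,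
      abs_of_pos (show 0 < 8 / η by positivity)] at hf
    rw [div_mul_eq_mul_div, div_lt_iff₀ hη] at hf
    linarith
  have hcompact : ∀ j, CompactSpace (G j) := fun j => isCompact_iff_compactSpace.1 (hGc j).isCompact
  have hfin : ∀ j, Finite (range (cell j)) := fun j => (hloc j).range_finite
  have hrep : ∀ j (l : range (cell j)), ∃ x : G j, cell j x = l := fun j l => l.2
  choose p hp using hrep
  have hc := fun j => exists_injective_approx (fun l : range (cell j) => φ j (p j l)) (half_pos hη)
  choose c hcinj hcφ using hc
  let v : ∀ j, G j → ℝ := fun j x => c j ⟨cell j x, mem_range_self x⟩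
  have hv : ∀ j, Continuous (v j) := by
    intro j
    refine IsLocallyConstant.continuous ?_
    rw [IsLocallyConstant.iff_eventually_eq]
    intro x
    filter_upwards [(IsLocallyConstant.iff_eventually_eq _).1 (hloc j) x] with y hy
    simp only [v, hy]
  have hvφ : ∀ j x, v j x - φ j x ∈ Icc (-η) η := by
    intro j x
    have h1 := abs_le.1 (hcφ j ⟨cell j x, mem_range_self x⟩)
    have h2 := abs_lt.1 <| hscale (φ j) _ _ <|
      hcell j (p j ⟨cell j x, mem_range_self x⟩) x (hp j _) (Sum.inr j)
    simp only [v, mem_Icc] at *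
    constructor <;> linarith
  have hext := fun j => ContinuousMap.exists_restrict_eq_forall_mem_of_closed
    (⟨fun x => v j x - φ j x, by have := hv j; fun_prop⟩ : C(G j, ℝ)) (hvφ j)
    ⟨0, by simpa using hη.le⟩ (hGc j)
  choose e heI he using hext
  have hψ : ∀ j (x : G j), (φ j + e j) x = v j x := by
    intro j x
    have := DFunLike.congr_fun (he j) x
    simp only [ContinuousMap.restrict_apply, ContinuousMap.coe_mk] at this
    rw [ContinuousMap.add_apply, this]
    ring
  obtain ⟨δ, hδ, hgap⟩ := exists_pos_forall_le_of_finite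
    (fun q : {q : Σ j, range (cell j) × range (cell j) // q.2.1 ≠ q.2.2} =>
      |c q.1.1 q.1.2.1 - c q.1.1 q.1.2.2|)
    (fun q => abs_pos.2 (sub_ne_zero.2 fun h0 => q.2 (hcinj _ h0)))
  refine ⟨fun j => φ j + e j, fun j x => ?_, G, δ, hδ, hGn, fun j x hx y hy hxy => ?_⟩
  · rw [ContinuousMap.add_apply, add_sub_cancel_left, abs_le]
    exact heI j x
  have hxy' : cell j ⟨x, hx⟩ = cell j ⟨y, hy⟩ := by
    by_contra hne
    have := hgap ⟨⟨j, ⟨_, mem_range_self ⟨x, hx⟩⟩, ⟨_, mem_range_self ⟨y, hy⟩⟩⟩,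
      fun h0 => hne (congrArg Subtype.val h0)⟩
    rw [hψ j ⟨x, hx⟩, hψ j ⟨y, hy⟩] at hxy
    exact (this.trans_lt hxy).false
  have hosc := hcell j ⟨x, hx⟩ ⟨y, hy⟩ hxy'
  refine ⟨fun i hi => ?_, fun j' => ?_⟩
  · refine (hscale (E i) x y ?_).trans (by linarith)
    exact hosc (Sum.inl ⟨i, Nat.lt_succ_of_le hi⟩)
  · have h1 := abs_lt.1 (hscale (φ j') x y (hosc (Sum.inr j')))
    have h2 := heI j' x
    have h3 := heI j' y
    simp only [ContinuousMap.add_apply, mem_Icc, abs_lt] at *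
    constructor <;> linarith

theorem ZeroFreeDenseOn.exists_forall_separatesUpTo [NormalSpace X] {n : ℕ}
    (h : ZeroFreeDenseOn (univ : Set X) (Fin (n + 1))) (N : ℕ) (E : ℕ → C(X, ℝ)) :
    ∃ φ : Fin N → C(X, ℝ), ∀ k : ℕ, SeparatesUpTo E φ n k (1 / (k + 1)) := by
  have hd : ∀ k : ℕ,
      Dense (interior {φ : Fin N → C(X, ℝ) | SeparatesUpTo E φ n k (1 / (k + 1))}) := by
    intro k
    rw [Metric.dense_iff]
    intro φ η hη
    have hk : (0 : ℝ) < 1 / (k + 1) / 2 := by positivity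
    obtain ⟨ψ, hψ, hs⟩ := h.exists_separatesUpTo E φ k (half_pos hη) hk
    refine ⟨ψ, ?_, ?_⟩
    · rw [Metric.mem_ball]
      refine lt_of_le_of_lt ((dist_pi_le_iff (half_pos hη).le).2 fun i => ?_) (half_lt_self hη)
      refine (ContinuousMap.dist_le (half_pos hη).le).2 fun x => ?_
      rw [Real.dist_eq]
      exact hψ i x
    · obtain ⟨ρ, hρ, hs'⟩ := hs.exists_forall_dist_le hk
      rw [mem_interior_iff_mem_nhds, Metric.mem_nhds_iff]
      refine ⟨ρ, hρ, fun χ hχ => ?_⟩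
      rw [mul_div_cancel₀ _ two_ne_zero] at hs'
      refine hs' χ fun j x => ?_
      rw [← Real.dist_eq]
      exact (ContinuousMap.dist_apply_le_dist x).trans
        ((dist_le_pi_dist χ ψ j).trans (Metric.mem_ball.1 hχ).le)
  obtain ⟨φ, hφ⟩ := (dense_iInter_of_isOpen (fun k => isOpen_interior) hd).nonempty
  exact ⟨φ, fun k => (interior_subset (mem_iInter.1 hφ k) :)⟩

/-- A continuous function constant on the common fibres of a countable family is controlled by
finitely many members of the family. -/
theorem exists_forall_abs_sub_lt_of_fibres {N : ℕ} (E : ℕ → C(X, ℝ)) (φ : Fin N → C(X, ℝ))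
    {f : C(X, ℝ)}
    (hf : ∀ x y, (∀ i, E i x = E i y) → (∀ j, φ j x = φ j y) → f x = f y) {η : ℝ} (hη : 0 < η) :
    ∃ k : ℕ, ∀ x y, (∀ i ≤ k, |E i x - E i y| < 1 / (k + 1)) →
      (∀ j, |φ j x - φ j y| < 1 / (k + 1)) → |f x - f y| < η := by
  by_contra! hcon
  let Z : ℕ → Set (X × X) := fun k => {p | (∀ i ≤ k, |E i p.1 - E i p.2| ≤ 1 / (k + 1)) ∧
    (∀ j, |φ j p.1 - φ j p.2| ≤ 1 / (k + 1)) ∧ η ≤ |f p.1 - f p.2|}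
  have hZc : ∀ k, IsClosed (Z k) := by
    intro k
    have hcl : ∀ g : C(X, ℝ), IsClosed {p : X × X | |g p.1 - g p.2| ≤ 1 / ((k : ℝ) + 1)} :=
      fun g => isClosed_le (by fun_prop) continuous_const
    have h1 : IsClosed {p : X × X | ∀ i ≤ k, |E i p.1 - E i p.2| ≤ 1 / ((k : ℝ) + 1)} := by
      simp only [ofPred_forall]
      exact isClosed_iInter fun i => isClosed_iInter fun _ => hcl _
    have h2 : IsClosed {p : X × X | ∀ j, |φ j p.1 - φ j p.2| ≤ 1 / ((k : ℝ) + 1)} := by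
      simp only [ofPred_forall]
      exact isClosed_iInter fun i => hcl _
    have h3 : IsClosed {p : X × X | η ≤ |f p.1 - f p.2|} :=
      isClosed_le continuous_const (by fun_prop)
    exact h1.inter (h2.inter h3)
  have hanti : ∀ k, Z (k + 1) ⊆ Z k := by
    intro k p hp
    have hk : 1 / (((k + 1 : ℕ) : ℝ) + 1) ≤ 1 / ((k : ℝ) + 1) :=
      one_div_le_one_div_of_le (by positivity) (by push_cast; linarith)
    exact ⟨fun i hi => (hp.1 i (hi.trans (Nat.le_succ k))).trans hk,
      fun j => (hp.2.1 j).trans hk, hp.2.2⟩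
  have hne : ∀ k, (Z k).Nonempty := by
    intro k
    obtain ⟨x, y, h1, h2, h3⟩ := hcon k
    exact ⟨(x, y), fun i hi => (h1 i hi).le, fun j => (h2 j).le, h3⟩
  obtain ⟨p, hp⟩ := IsCompact.nonempty_iInter_of_sequence_nonempty_isCompact_isClosed Z hanti hne
    (hZc 0).isCompact hZc
  rw [mem_iInter] at hp
  have hzero : ∀ (a : ℝ) (i : ℕ), (∀ k ≥ i, |a| ≤ 1 / ((k : ℝ) + 1)) → a = 0 := by
    intro a i ha
    rw [← abs_eq_zero]
    refine le_antisymm (ge_of_tendsto tendsto_one_div_add_atTop_nhds_zero_nat ?_) (abs_nonneg _)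
    filter_upwards [Filter.eventually_ge_atTop i] with k hk using ha k hk
  have h0 : f p.1 = f p.2 := hf _ _
    (fun i => sub_eq_zero.1 (hzero _ i fun k hk => (hp k).1 i hk))
    (fun j => sub_eq_zero.1 (hzero _ 0 fun k _ => (hp k).2.1 j))
  have := (hp 0).2.2
  rw [h0, sub_self, abs_zero] at this
  exact absurd hη this.not_gt

/-- A function which is uniformly approximable on `G` in terms of `φ` is, up to `η`, a composition
with `φ` on `G`. -/
theorem exists_comp_approx (f φ : C(X, ℝ)) (G : Set X) {δ η : ℝ} (hδ : 0 < δ)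
    (h : ∀ x ∈ G, ∀ y ∈ G, |φ x - φ y| < δ → |f x - f y| ≤ η) :
    ∃ g : C(ℝ, ℝ), (∀ s, |g s| ≤ ‖f‖) ∧ ∀ x ∈ G, |f x - g (φ x)| ≤ η := by
  obtain ⟨g, hg⟩ := exists_continuous_forall_mem_convex_of_local_const
    (t := fun s : ℝ => {c : ℝ | |c| ≤ ‖f‖ ∧ ∀ x ∈ G, φ x = s → |f x - c| ≤ η})
    (fun s => by
      have : {c : ℝ | |c| ≤ ‖f‖ ∧ ∀ x ∈ G, φ x = s → |f x - c| ≤ η} =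
          Icc (-‖f‖) ‖f‖ ∩ ⋂ x ∈ G, ⋂ _ : φ x = s, Icc (f x - η) (f x + η) := by
        ext c
        simp only [mem_ofPred_eq, mem_inter_iff, mem_iInter, mem_Icc, abs_le]
        refine and_congr_right fun _ => forall₃_congr fun x _ _ => ?_
        constructor <;> rintro ⟨h1, h2⟩ <;> constructor <;> linarith
      rw [this]
      exact (convex_Icc _ _).inter <| convex_iInter fun x => convex_iInter fun _ =>
        convex_iInter fun _ => convex_Icc _ _)
    (fun s => by
      by_cases hs : ∃ x ∈ G, |φ x - s| < δ / 2
      · obtain ⟨x₀, hx₀, hs⟩ := hs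
        refine ⟨f x₀, ?_⟩
        filter_upwards [Metric.ball_mem_nhds s (half_pos hδ)] with r hr
        refine ⟨f.norm_coe_le_norm x₀, fun x hx hxr => h x hx x₀ hx₀ ?_⟩
        rw [Metric.mem_ball, Real.dist_eq] at hr
        rw [hxr]
        rw [abs_lt] at *
        constructor <;> linarith
      · push Not at hs
        refine ⟨0, ?_⟩
        filter_upwards [Metric.ball_mem_nhds s (half_pos hδ)] with r hr
        refine ⟨by simp, fun x hx hxr => absurd (hs x hx) (not_le.2 ?_)⟩
        rwa [hxr, ← Real.dist_eq])
  exact ⟨g, fun s => (hg s).1, fun x hx => (hg (φ x)).2 x hx rfl⟩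

theorem exists_sum_comp_approx {n : ℕ} {E : ℕ → C(X, ℝ)} {φ : Fin (4 * (n + 1)) → C(X, ℝ)}
    (hφ : ∀ k : ℕ, SeparatesUpTo E φ n k (1 / (k + 1))) {f : C(X, ℝ)}
    (hf : ∀ x y, (∀ i, E i x = E i y) → (∀ j, φ j x = φ j y) → f x = f y) :
    ∃ g : Fin (4 * (n + 1)) → BoundedContinuousFunction ℝ ℝ, (∀ j, ‖g j‖ ≤ ‖f‖) ∧
      ∀ x, |f x - ∑ j, g j (φ j x)| ≤ 3 / 4 * ‖f‖ := by
  rcases (norm_nonneg f).eq_or_lt with h0 | hpos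
  · refine ⟨0, by simp, fun x => ?_⟩
    have := f.norm_coe_le_norm x
    rw [← h0] at this ⊢
    simpa using this
  obtain ⟨k, hk⟩ := exists_forall_abs_sub_lt_of_fibres E φ hf (η := ‖f‖ / 4) (by positivity)
  obtain ⟨G, δ, hδ, hG, hs⟩ := hφ k
  have hg := fun j => exists_comp_approx f (φ j) (G j) hδ (η := ‖f‖ / 4)
    fun x hx y hy hxy => (hk x y (hs j x hx y hy hxy).1 (hs j x hx y hy hxy).2).le
  choose g hgf hgG using hg
  have hN : (0 : ℝ) < 4 * (n + 1) := by positivity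
  refine ⟨fun j => (4 * ((n : ℝ) + 1))⁻¹ •
    BoundedContinuousFunction.ofNormedAddCommGroup (g j) (g j).continuous ‖f‖ (hgf j),
    fun j => ?_, fun x => ?_⟩
  · rw [norm_smul, Real.norm_of_nonneg (by positivity)]
    refine (mul_le_of_le_one_left (norm_nonneg _) (inv_le_one_of_one_le₀ ?_)).trans
      (BoundedContinuousFunction.norm_ofNormedAddCommGroup_le _ hpos.le _)
    linarith [(Nat.cast_nonneg n : (0 : ℝ) ≤ n)]
  · classical
    have hterm : ∀ j, |f x - g j (φ j x)| ≤ ‖f‖ / 4 + if x ∉ G j then 2 * ‖f‖ else 0 := by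
      intro j
      by_cases hx : x ∉ G j
      · rw [if_pos hx]
        have h1 := abs_le.1 (f.norm_coe_le_norm x)
        have h2 := abs_le.1 (hgf j (φ j x))
        rw [abs_le]
        constructor <;> linarith
      · rw [if_neg hx, add_zero]
        exact hgG j x (not_not.1 hx)
    have hcard : ((Finset.univ.filter fun j => x ∉ G j).card : ℝ) ≤ n := by
      have := hG x
      rw [Set.ncard_eq_toFinset_card'] at this
      simpa using this
    have hsum : ∑ j, |f x - g j (φ j x)| ≤ 4 * (n + 1) * (‖f‖ / 4) + n * (2 * ‖f‖) := by
      refine (Finset.sum_le_sum fun j _ => hterm j).trans ?_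
      rw [Finset.sum_add_distrib, ← Finset.sum_filter, Finset.sum_const, Finset.sum_const,
        Finset.card_univ, Fintype.card_fin, nsmul_eq_mul, nsmul_eq_mul]
      push_cast
      gcongr
    have heq : f x - ∑ j, ((4 * ((n : ℝ) + 1))⁻¹ • BoundedContinuousFunction.ofNormedAddCommGroup
        (g j) (g j).continuous ‖f‖ (hgf j)) (φ j x) =
        (4 * ((n : ℝ) + 1))⁻¹ * ∑ j, (f x - g j (φ j x)) := by
      simp only [BoundedContinuousFunction.coe_smul,
        BoundedContinuousFunction.coe_ofNormedAddCommGroup, smul_eq_mul]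
      rw [Finset.sum_sub_distrib, ← Finset.mul_sum, Finset.sum_const, Finset.card_univ,
        Fintype.card_fin, nsmul_eq_mul, mul_sub]
      push_cast
      field_simp
    rw [heq, abs_mul, abs_of_pos (by positivity), inv_mul_le_iff₀ hN]
    refine (Finset.abs_sum_le_sum_abs _ _).trans (hsum.trans ?_)
    nlinarith

theorem exists_sum_comp_eq {n : ℕ} {E : ℕ → C(X, ℝ)} {φ : Fin (4 * (n + 1)) → C(X, ℝ)}
    (hφ : ∀ k : ℕ, SeparatesUpTo E φ n k (1 / (k + 1))) {f : C(X, ℝ)}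
    (hf : ∀ x y, (∀ i, E i x = E i y) → f x = f y) :
    ∃ g : Fin (4 * (n + 1)) → C(ℝ, ℝ), ∀ x, f x = ∑ j, g j (φ j x) := by
  let P : Type _ :=
    {f : C(X, ℝ) // ∀ x y, (∀ i, E i x = E i y) → (∀ j, φ j x = φ j y) → f x = f y}
  have hstep := fun f : P => exists_sum_comp_approx hφ f.2
  choose g hg hgf using hstep
  let next : P → P := fun f => ⟨f.1 - ∑ j, (g f j).toContinuousMap.comp (φ j), fun x y hE hφ' => by
    simp only [ContinuousMap.sub_apply, ContinuousMap.coe_sum, Finset.sum_apply,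
      ContinuousMap.comp_apply, hφ', f.2 x y hE hφ']⟩
  let F : ℕ → P := fun m => next^[m] ⟨f, fun x y hE _ => hf x y hE⟩
  have hF : ∀ m x, (F (m + 1)).1 x = (F m).1 x - ∑ j, g (F m) j (φ j x) := by
    intro m x
    simp only [F, Function.iterate_succ_apply']
    simp only [next, ContinuousMap.sub_apply, ContinuousMap.coe_sum, Finset.sum_apply,
      ContinuousMap.comp_apply, BoundedContinuousFunction.coe_toContinuousMap]
  have hnorm : ∀ m, ‖(F m).1‖ ≤ (3 / 4) ^ m * ‖f‖ := by
    intro m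
    induction m with
    | zero => simp [F]
    | succ m ih =>
      have h0 : 0 ≤ ‖(F m).1‖ := norm_nonneg _
      refine ((ContinuousMap.norm_le _ (by positivity : 0 ≤ 3 / 4 * ‖(F m).1‖)).2 fun x => ?_).trans
        ?_
      · rw [hF, Real.norm_eq_abs]
        exact hgf _ x
      · rw [pow_succ']
        linarith
  have hgeo : Summable fun m : ℕ => (3 / 4 : ℝ) ^ m * ‖f‖ :=
    (summable_geometric_of_lt_one (by norm_num) (by norm_num)).mul_right _
  have hsum : ∀ j, Summable fun m => g (F m) j := fun j =>
    Summable.of_norm_bounded hgeo fun m => (hg _ j).trans (hnorm m)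
  refine ⟨fun j => (∑' m, g (F m) j).toContinuousMap, fun x => ?_⟩
  have h1 : HasSum (fun m => ∑ j, g (F m) j (φ j x)) (∑ j, (∑' m, g (F m) j) (φ j x)) :=
    hasSum_sum fun j _ =>
      (hsum j).hasSum.mapL (BoundedContinuousFunction.evalCLM ℝ (φ j x))
  have h2 : ∀ m, ∑ l ∈ Finset.range m, ∑ j, g (F l) j (φ j x) = f x - (F m).1 x := by
    intro m
    induction m with
    | zero => simp [F]
    | succ m ih =>
      rw [Finset.sum_range_succ, ih, hF]
      ring
  have h3 : Filter.Tendsto (fun m => (F m).1 x) Filter.atTop (𝓝 0) :=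
    squeeze_zero_norm (fun m => ((F m).1.norm_coe_le_norm x).trans (hnorm m))
      hgeo.tendsto_atTop_zero
  have h4 := h1.tendsto_sum_nat
  simp only [h2] at h4
  have h5 := h3.const_sub (f x)
  rw [sub_zero] at h5
  exact tendsto_nhds_unique h5 h4

/-- In a finite-dimensional compact Hausdorff space, the functions constant on the fibres of a
countable family are superpositions of finitely many fixed functions. -/
theorem DimLE.exists_superposition [T2Space X] {n : ℕ} (h : DimLE X n) (E : ℕ → C(X, ℝ)) :
    ∃ φ : Fin (4 * (n + 1)) → C(X, ℝ), ∀ f : C(X, ℝ),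
      (∀ x y, (∀ i, E i x = E i y) → f x = f y) →
        ∃ g : Fin (4 * (n + 1)) → C(ℝ, ℝ), ∀ x, f x = ∑ j, g j (φ j x) := by
  obtain ⟨φ, hφ⟩ := h.zeroFreeDenseOn.exists_forall_separatesUpTo (4 * (n + 1)) E
  exact ⟨φ, fun f hf => exists_sum_comp_eq hφ hf⟩

end Superposition

section Cofinality

variable {κ : Cardinal.{u}} {α : Type u}

theorem cofCtblSubsets_le {J : Type u} (hα : #α = κ) (A : J → Set α)
    (hA : ∀ j, (A j).Countable)
    (hcof : ∀ S : Set α, S.Countable → S.Infinite → ∃ j, S ⊆ A j) : cofCtblSubsets κ ≤ #J := by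
  obtain ⟨e⟩ : Nonempty (κ.out ≃ α) := Cardinal.eq.1 (by rw [mk_out, hα])
  refine le_trans (b := #{C : Set κ.out | C.Infinite ∧ ∃ j, e ⁻¹' A j = C})
    (csInf_le' ⟨_, ?_, fun S hS hSi => ?_, rfl⟩) ?_
  · rintro _ ⟨hi, j, rfl⟩
    exact ⟨(hA j).preimage e.injective, hi⟩
  · obtain ⟨j, hj⟩ := hcof (e '' S) (hS.image e) (hSi.image e.injective.injOn)
    have hSj : S ⊆ e ⁻¹' A j := image_subset_iff.1 hj
    exact ⟨_, ⟨hSi.mono hSj, j, rfl⟩, hSj⟩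
  · refine (mk_le_mk_of_subset (t := range fun j => e ⁻¹' A j) ?_).trans mk_range_le
    rintro _ ⟨-, j, rfl⟩
    exact ⟨j, rfl⟩

theorem exists_cofinal_mk_eq_cofCtblSubsets (hα : #α = κ) :
    ∃ (J : Type u) (A : J → Set α), (∀ j, (A j).Countable ∧ (A j).Infinite) ∧
      (∀ S : Set α, S.Countable → S.Infinite → ∃ j, S ⊆ A j) ∧ #J = cofCtblSubsets κ := by
  obtain ⟨e⟩ : Nonempty (κ.out ≃ α) := Cardinal.eq.1 (by rw [mk_out, hα])
  obtain ⟨𝒞, h𝒞, hcof, hcard⟩ := csInf_mem (s := { c | ∃ 𝒞 : Set (Set κ.out),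
    (∀ C ∈ 𝒞, C.Countable ∧ C.Infinite) ∧
    (∀ S : Set κ.out, S.Countable → S.Infinite → ∃ C ∈ 𝒞, S ⊆ C) ∧ #𝒞 = c })
    ⟨_, {C | C.Countable ∧ C.Infinite}, fun C hC => hC,
      fun S hS hSi => ⟨S, ⟨hS, hSi⟩, Subset.rfl⟩, rfl⟩
  refine ⟨𝒞, fun C => e '' C, fun C => ⟨(h𝒞 C C.2).1.image e,
    (h𝒞 C C.2).2.image e.injective.injOn⟩, fun S hS hSi => ?_, hcard⟩
  obtain ⟨C, hC, hSC⟩ := hcof (e ⁻¹' S) (hS.preimage e.injective)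
    (hSi.preimage (by simp [e.surjective.range_eq]))
  refine ⟨⟨C, hC⟩, ?_⟩
  rw [← image_preimage_eq S e.surjective]
  exact image_mono hSC

/-- A family of countable sets through which all countable sets factor. -/
theorem exists_enumeration_mk_eq_cofCtblSubsets (hα : #α = κ) (hκ : ℵ₀ ≤ κ) :
    ∃ (J : Type u) (e : J → ℕ → α),
      (∀ S : Set α, S.Countable → ∃ j, S ⊆ range (e j)) ∧ #J = cofCtblSubsets κ := by
  obtain ⟨J, A, hA, hcof, hJ⟩ := exists_cofinal_mk_eq_cofCtblSubsets hα
  have hinf : Infinite α := by rwa [infinite_iff, hα]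
  have henum := fun j => (hA j).1.exists_eq_range (hA j).2.nonempty
  choose e he using henum
  refine ⟨J, e, fun S hS => ?_, hJ⟩
  let t := Infinite.natEmbedding α
  obtain ⟨j, hj⟩ := hcof (S ∪ range t) (hS.union (countable_range t))
    ((infinite_range_of_injective t.injective).mono subset_union_right)
  exact ⟨j, (he j) ▸ subset_union_left.trans hj⟩

theorem aleph0_lt_cofCtblSubsets (hκ : ℵ₀ < κ) : ℵ₀ < cofCtblSubsets κ := by
  obtain ⟨J, e, hcof, hJ⟩ := exists_enumeration_mk_eq_cofCtblSubsets (mk_out κ) hκ.le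
  rw [← hJ]
  by_contra! hle
  have hJc : Countable J := mk_le_aleph0_iff.1 hle
  have huniv : (univ : Set κ.out) ⊆ ⋃ j, range (e j) := by
    intro x _
    obtain ⟨j, hj⟩ := hcof {x} (countable_singleton x)
    exact mem_iUnion.2 ⟨j, hj rfl⟩
  have hc : (univ : Set κ.out).Countable := (countable_iUnion fun j => countable_range _).mono huniv
  have := mk_le_aleph0_iff.2 (countable_univ_iff.1 hc)
  rw [mk_out] at this
  exact this.not_gt hκ

theorem power_aleph0_le_cofCtblSubsets_mul (hκ : ℵ₀ ≤ κ) :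
    κ ^ ℵ₀ ≤ cofCtblSubsets κ * 𝔠 := by
  obtain ⟨J, e, hcof, hJ⟩ := exists_enumeration_mk_eq_cofCtblSubsets (mk_out κ) hκ
  have hsurj : Function.Surjective fun p : J × (ℕ → ℕ) => fun m => e p.1 (p.2 m) := by
    intro t
    obtain ⟨j, hj⟩ := hcof (range t) (countable_range t)
    have : ∀ m, ∃ a, e j a = t m := fun m => hj (mem_range_self m)
    choose a ha using this
    exact ⟨(j, a), funext ha⟩
  have := mk_le_of_surjective hsurj
  simpa [hJ] using this

end Cofinality

section Weight

variable {X : Type u} [TopologicalSpace X]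

theorem exists_isTopologicalBasis_mk_eq_weightCard :
    ∃ B : Set (Set X), TopologicalSpace.IsTopologicalBasis B ∧ #B = weightCard X :=
  csInf_mem (s := {c | ∃ B : Set (Set X), TopologicalSpace.IsTopologicalBasis B ∧ #B = c})
    ⟨_, _, TopologicalSpace.isTopologicalBasis_opens, rfl⟩

theorem IsCompact.exists_finset_basis_subset {B : Set (Set X)}
    (hB : TopologicalSpace.IsTopologicalBasis B) {C U : Set X} (hC : IsCompact C) (hU : IsOpen U)
    (hCU : C ⊆ U) : ∃ F : Finset B, C ⊆ ⋃ b ∈ F, b.1 ∧ ⋃ b ∈ F, b.1 ⊆ U := by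
  obtain ⟨t, ht⟩ := hC.elim_finite_subcover (fun b : {b : B // b.1 ⊆ U} => b.1.1)
    (fun b => hB.isOpen b.1.2) (fun x hx => by
      obtain ⟨b, hb, hxb, hbU⟩ := hB.exists_subset_of_mem_open (hCU hx) hU
      exact mem_iUnion.2 ⟨⟨⟨b, hb⟩, hbU⟩, hxb⟩)
  refine ⟨t.map (Function.Embedding.subtype _), fun x hx => ?_, ?_⟩
  · obtain ⟨b, hb, hxb⟩ := mem_iUnion₂.1 (ht hx)
    exact mem_iUnion₂.2 ⟨b.1, Finset.mem_map_of_mem _ hb, hxb⟩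
  · refine iUnion₂_subset fun b hb => ?_
    obtain ⟨b', -, rfl⟩ := Finset.mem_map.1 hb
    exact b'.2

variable [CompactSpace X] [T2Space X]

/-- Weight many functions suffice to separate all pairs of level sets. -/
theorem exists_separating_family (hw : ℵ₀ ≤ weightCard X) :
    ∃ (ι : Type u) (u : ι → C(X, ℝ)), #ι = weightCard X ∧ ∀ (f : C(X, ℝ)) (p q : ℝ), p < q →
      ∃ i, (∀ x, f x ≤ p → u i x = 0) ∧ ∀ x, q ≤ f x → u i x = 1 := by
  obtain ⟨B, hB, hBw⟩ := exists_isTopologicalBasis_mk_eq_weightCard (X := X)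
  have hinf : Infinite B := by rwa [infinite_iff, hBw]
  have hu : ∀ i : Finset B × Finset B, ∃ u : C(X, ℝ),
      Disjoint (closure (⋃ b ∈ i.1, b.1)) (closure (⋃ b ∈ i.2, b.1)) →
        (∀ x ∈ ⋃ b ∈ i.1, b.1, u x = 0) ∧ ∀ x ∈ ⋃ b ∈ i.2, b.1, u x = 1 := by
    intro i
    by_cases hd : Disjoint (closure (⋃ b ∈ i.1, b.1)) (closure (⋃ b ∈ i.2, b.1))
    · obtain ⟨u, h0, h1, -⟩ :=
        exists_continuous_zero_one_of_isClosed isClosed_closure isClosed_closure hd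
      exact ⟨u, fun _ => ⟨fun x hx => h0 (subset_closure hx), fun x hx => h1 (subset_closure hx)⟩⟩
    · exact ⟨0, fun h => absurd h hd⟩
  choose u hu using hu
  refine ⟨Finset B × Finset B, u, ?_, fun f p q hpq => ?_⟩
  · rw [mk_prod, lift_id, mk_finset_of_infinite, mul_eq_self (infinite_iff.1 hinf), hBw]
  obtain ⟨r, hpr, hrq⟩ := exists_between hpq
  obtain ⟨s, hrs, hsq⟩ := exists_between hrq
  obtain ⟨F₁, hF₁, hF₁'⟩ := IsCompact.exists_finset_basis_subset hB
    (isClosed_le f.continuous continuous_const : IsClosed {x | f x ≤ p}).isCompact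
    (isOpen_lt f.continuous continuous_const : IsOpen {x | f x < r})
    (fun x hx => lt_of_le_of_lt hx hpr)
  obtain ⟨F₂, hF₂, hF₂'⟩ := IsCompact.exists_finset_basis_subset hB
    (isClosed_le continuous_const f.continuous : IsClosed {x | q ≤ f x}).isCompact
    (isOpen_lt continuous_const f.continuous : IsOpen {x | s < f x})
    (fun x hx => lt_of_lt_of_le hsq hx)
  have h₁ : closure (⋃ b ∈ F₁, b.1) ⊆ {x | f x ≤ r} :=
    closure_minimal (hF₁'.trans fun x (hx : f x < r) => hx.le)
      (isClosed_le f.continuous continuous_const)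
  have h₂ : closure (⋃ b ∈ F₂, b.1) ⊆ {x | s ≤ f x} :=
    closure_minimal (hF₂'.trans fun x (hx : s < f x) => hx.le)
      (isClosed_le continuous_const f.continuous)
  obtain ⟨h0, h1⟩ := hu (F₁, F₂) (Set.disjoint_left.2 fun x hx hx' =>
    ((h₁ hx).trans_lt hrs).not_ge (h₂ hx'))
  exact ⟨(F₁, F₂), fun x hx => h0 x (hF₁ hx), fun x hx => h1 x (hF₂ hx)⟩

theorem mk_continuousMap_le_weightCard_power (hw : ℵ₀ ≤ weightCard X) :
    #C(X, ℝ) ≤ weightCard X ^ ℵ₀ := by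
  obtain ⟨ι, u, hι, hu⟩ := exists_separating_family hw
  have hs : ∀ (f : C(X, ℝ)) (r : {r : ℚ × ℚ // r.1 < r.2}),
      ∃ i, (∀ x, f x ≤ (r.1.1 : ℝ) → u i x = 0) ∧ ∀ x, (r.1.2 : ℝ) ≤ f x → u i x = 1 :=
    fun f r => hu f _ _ (by exact_mod_cast r.2)
  choose s hs0 hs1 using hs
  have hlt : ∀ f g : C(X, ℝ), s f = s g → ∀ x, ¬ f x < g x := by
    intro f g hfg x hx
    obtain ⟨p, hfp, hpg⟩ := exists_rat_btwn hx
    obtain ⟨q, hpq, hqg⟩ := exists_rat_btwn hpg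
    let r : {r : ℚ × ℚ // r.1 < r.2} := ⟨(p, q), by exact_mod_cast hpq⟩
    have h0 := hs0 f r x hfp.le
    have h1 := hs1 g r x hqg.le
    rw [hfg, h1] at h0
    exact one_ne_zero h0
  have hinj : Function.Injective s := fun f g hfg => ContinuousMap.ext fun x =>
    le_antisymm (not_lt.1 (hlt g f hfg.symm x)) (not_lt.1 (hlt f g hfg x))
  have hne : Nonempty {r : ℚ × ℚ // r.1 < r.2} := ⟨⟨(0, 1), one_pos⟩⟩
  refine (mk_le_of_injective hinj).trans ?_
  rw [mk_arrow, hι, lift_uzero]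
  refine power_le_power_left (aleph0_pos.trans_le hw).ne' ?_
  rw [lift_le_aleph0]
  exact mk_le_aleph0

theorem exists_countable_determining_family (hw : ℵ₀ ≤ weightCard X) :
    ∃ (ι : Type u) (u : ι → C(X, ℝ)), #ι = weightCard X ∧ ∀ f : C(X, ℝ), ∃ S : Set ι,
      S.Countable ∧ ∀ x y, (∀ i ∈ S, u i x = u i y) → f x = f y := by
  obtain ⟨ι, u, hι, hu⟩ := exists_separating_family hw
  refine ⟨ι, u, hι, fun f => ?_⟩
  have hs : ∀ r : {r : ℚ × ℚ // r.1 < r.2},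
      ∃ i, (∀ x, f x ≤ (r.1.1 : ℝ) → u i x = 0) ∧ ∀ x, (r.1.2 : ℝ) ≤ f x → u i x = 1 :=
    fun r => hu f _ _ (by exact_mod_cast r.2)
  choose s hs0 hs1 using hs
  have hlt : ∀ x y, (∀ i ∈ range s, u i x = u i y) → ¬ f x < f y := by
    intro x y hxy hlt
    obtain ⟨p, hxp, hpy⟩ := exists_rat_btwn hlt
    obtain ⟨q, hpq, hqy⟩ := exists_rat_btwn hpy
    let r : {r : ℚ × ℚ // r.1 < r.2} := ⟨(p, q), by exact_mod_cast hpq⟩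
    have h0 := hs0 r x hxp.le
    rw [hxy _ (mem_range_self r), hs1 r y hqy.le] at h0
    exact one_ne_zero h0
  exact ⟨range s, countable_range s, fun x y hxy =>
    le_antisymm (not_lt.1 (hlt y x fun i hi => (hxy i hi).symm)) (not_lt.1 (hlt x y hxy))⟩

end Weight

section Bounds

variable {X : Type u} [TopologicalSpace X]

theorem basicCard_le_mk {Φ : Set C(X, ℝ)} (hΦ : IsBasicFamily Φ) : basicCard X ≤ #Φ :=
  csInf_le' ⟨Φ, hΦ, rfl⟩

theorem isBasicFamily_univ : IsBasicFamily (univ : Set C(X, ℝ)) := fun f =>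
  ⟨1, fun _ => f, fun _ => ContinuousMap.id ℝ, fun _ => mem_univ _, fun x => by simp⟩

theorem exists_isBasicFamily_mk_eq_basicCard :
    ∃ Φ : Set C(X, ℝ), IsBasicFamily Φ ∧ #Φ = basicCard X :=
  csInf_mem (s := {c | ∃ Φ : Set C(X, ℝ), IsBasicFamily Φ ∧ #Φ = c})
    ⟨_, _, isBasicFamily_univ, rfl⟩

/-- The points of `D` which the values of `φ` isolate among all points of `D`. -/
def isolatedPoints (D : Set X) {m : ℕ} (φ : Fin m → C(X, ℝ)) : Set D :=
  {d | ∃ V : Set (Fin m → ℝ), IsOpen V ∧ ∀ d' : D, (fun i => φ i d') ∈ V ↔ d' = d}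

theorem countable_isolatedPoints (D : Set X) {m : ℕ} (φ : Fin m → C(X, ℝ)) :
    (isolatedPoints D φ).Countable := by
  have hsub : isolatedPoints D φ ⊆ ⋃ b ∈ TopologicalSpace.countableBasis (Fin m → ℝ),
      {d | ∀ d' : D, (fun i => φ i d') ∈ b ↔ d' = d} := by
    rintro d ⟨V, hV, hd⟩
    obtain ⟨b, hb, hdb, hbV⟩ := (TopologicalSpace.isBasis_countableBasis _).exists_subset_of_mem_open
      ((hd d).2 rfl) hV
    refine mem_iUnion₂.2 ⟨b, hb, fun d' => ⟨fun h => (hd d').1 (hbV h), ?_⟩⟩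
    rintro rfl
    exact hdb
  refine Set.Countable.mono hsub ((TopologicalSpace.countable_countableBasis _).biUnion
    fun b _ => Set.Subsingleton.countable fun d hd d' hd' => ?_)
  exact (hd' d).1 ((hd d).2 rfl)

variable [CompactSpace X] [T2Space X]

theorem DimLE.basicCard_le {n : ℕ} (h : DimLE X n) (hw : ℵ₀ < weightCard X) :
    basicCard X ≤ cofCtblSubsets (weightCard X) := by
  obtain ⟨ι, u, hι, hu⟩ := exists_countable_determining_family hw.le
  obtain ⟨J, e, hcof, hJ⟩ := exists_enumeration_mk_eq_cofCtblSubsets hι hw.le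
  have hsup := fun j => h.exists_superposition fun m => u (e j m)
  choose φ hφ using hsup
  have hbasic : IsBasicFamily (range fun p : J × Fin (4 * (n + 1)) => φ p.1 p.2) := by
    intro f
    obtain ⟨S, hS, hf⟩ := hu f
    obtain ⟨j, hj⟩ := hcof S hS
    obtain ⟨g, hg⟩ := hφ j f fun x y hxy => hf x y fun i hi => by
      obtain ⟨m, rfl⟩ := hj hi
      exact hxy m
    exact ⟨_, φ j, g, fun i => ⟨(j, i), rfl⟩, hg⟩
  have hJ0 : ℵ₀ ≤ #J := hJ ▸ (aleph0_lt_cofCtblSubsets hw).le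
  refine (basicCard_le_mk hbasic).trans (mk_range_le.trans ?_)
  rw [← hJ, mk_prod, lift_uzero]
  exact mul_le_of_le hJ0 le_rfl (lift_le_aleph0.2 mk_le_aleph0 |>.trans hJ0)

/-- A countable subset of a discrete subspace is isolated by the values of one function. -/
theorem exists_continuousMap_isolating {D : Set X} (hD : DiscreteTopology D) {s : ℕ → D}
    (hs : Function.Injective s) : ∃ f : C(X, ℝ), ∀ n, ∃ W : Set ℝ, IsOpen W ∧
      ∀ d : D, f d ∈ W ↔ d = s n := by
  have hbump : ∀ d : D, ∃ h : C(X, ℝ), h d = 1 ∧ (∀ d' : D, d' ≠ d → h d' = 0) ∧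
      ∀ x, h x ∈ Icc (0 : ℝ) 1 := by
    intro d
    obtain ⟨U, hU, hUd⟩ := isOpen_induced_iff.1 (isOpen_discrete ({d} : Set D))
    have hmem : ∀ d' : D, (d' : X) ∈ U ↔ d' = d := fun d' => by
      rw [← mem_singleton_iff, ← hUd, mem_preimage]
    obtain ⟨h, h0, h1, hI⟩ := exists_continuous_zero_one_of_isClosed hU.isClosed_compl
      (isClosed_singleton (x := (d : X)))
      (disjoint_singleton_right.2 fun hd => hd ((hmem d).2 rfl))
    exact ⟨h, h1 rfl, fun d' hd' => h0 fun h => hd' ((hmem d').1 h), hI⟩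
  choose h hh1 hh0 hhI using hbump
  have hsum : Summable fun n => (1 / 2 : ℝ) ^ n • h (s n) := by
    refine Summable.of_norm_bounded summable_geometric_two fun n => ?_
    refine (ContinuousMap.norm_le _ (by positivity)).2 fun x => ?_
    have hx := hhI (s n) x
    rw [ContinuousMap.smul_apply, smul_eq_mul, Real.norm_of_nonneg (by have := hx.1; positivity)]
    exact mul_le_of_le_one_right (by positivity) hx.2
  refine ⟨∑' n, (1 / 2 : ℝ) ^ n • h (s n), fun n =>
    ⟨Ioo (3 / 4 * (1 / 2) ^ n) (3 / 2 * (1 / 2) ^ n), isOpen_Ioo, fun d => ?_⟩⟩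
  rw [← ContinuousMap.tsum_apply hsum]
  simp only [ContinuousMap.smul_apply, smul_eq_mul]
  have hpow : ∀ m, (0 : ℝ) < (1 / 2) ^ m := fun m => by positivity
  by_cases hd : ∃ m, s m = d
  · obtain ⟨m, rfl⟩ := hd
    rw [tsum_eq_single m fun l hl => by rw [hh0 _ _ fun hsl => hl (hs hsl).symm, mul_zero], hh1,
      mul_one, hs.eq_iff, mem_Ioo]
    constructor
    · rintro ⟨h1, h2⟩
      rcases lt_trichotomy m n with hmn | hmn | hmn
      · have := pow_le_pow_of_le_one (by norm_num : (0 : ℝ) ≤ 1 / 2) (by norm_num) hmn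
        rw [pow_succ] at this
        linarith [hpow m, hpow n]
      · exact hmn
      · have := pow_le_pow_of_le_one (by norm_num : (0 : ℝ) ≤ 1 / 2) (by norm_num) hmn
        rw [pow_succ] at this
        linarith [hpow m, hpow n]
    · rintro rfl
      constructor <;> linarith [hpow m]
  · push Not at hd
    have hzero : ∀ m, (1 / 2 : ℝ) ^ m * h (s m) d = 0 := fun m => by
      rw [hh0 _ _ (hd m).symm, mul_zero]
    simp only [hzero, tsum_zero]
    refine ⟨fun h0 => absurd h0.1 (not_lt.2 (by positivity)), fun h0 => absurd h0.symm (hd n)⟩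

theorem cofCtblSubsets_le_of_isBasicFamily (hw : ℵ₀ < weightCard X) {D : Set X}
    (hD : DiscreteTopology D) (hcard : #D = weightCard X) {Φ : Set C(X, ℝ)}
    (hΦ : IsBasicFamily Φ) : cofCtblSubsets (weightCard X) ≤ #Φ := by
  have hle : cofCtblSubsets (weightCard X) ≤ #(Σ m, Fin m → Φ) := by
    refine cofCtblSubsets_le hcard
      (fun p : Σ m, Fin m → Φ => isolatedPoints D fun i => (p.2 i : C(X, ℝ)))
      (fun p => countable_isolatedPoints D _) fun S hS hSi => ?_
    obtain ⟨hden⟩ := countable_infinite_iff_nonempty_denumerable.1 ⟨hS, hSi⟩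
    let t : ℕ ≃ S := (Denumerable.eqv S).symm
    obtain ⟨f, hf⟩ := exists_continuousMap_isolating hD
      (Subtype.val_injective.comp t.injective : Function.Injective fun n => (t n : D))
    obtain ⟨m, φ, g, hφ, hfg⟩ := hΦ f
    refine ⟨⟨m, fun i => ⟨φ i, hφ i⟩⟩, fun d hd => ?_⟩
    obtain ⟨W, hW, hWd⟩ := hf (t.symm ⟨d, hd⟩)
    refine ⟨{p | ∑ i, g i (p i) ∈ W}, hW.preimage (by fun_prop), fun d' => ?_⟩
    rw [mem_ofPred_eq, ← hfg, hWd, Function.comp_apply, Equiv.apply_symm_apply]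
  rw [← mk_congr List.equivSigmaTuple] at hle
  have h0 := aleph0_lt_cofCtblSubsets hw
  exact (le_max_iff.1 (hle.trans (mk_list_le_max Φ))).resolve_left h0.not_ge

end Bounds

theorem stmt15 (K : Type u) [TopologicalSpace K] [CompactSpace K] [T2Space K]
    (hw : ℵ₀ < weightCard K) (D : Set K) (hD : DiscreteTopology D)
    (hcard : #D = weightCard K) :
    ((∃ n, DimLE K n) ∧ basicCard K = cofCtblSubsets (weightCard K)) ∨
    ((∀ n, ¬ DimLE K n) ∧ basicCard K = #C(K, ℝ) ∧
      #C(K, ℝ) = weightCard K ^ ℵ₀) := by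
  obtain ⟨Φ, hΦ, hΦc⟩ := exists_isBasicFamily_mk_eq_basicCard (X := K)
  have hcof : cofCtblSubsets (weightCard K) ≤ basicCard K :=
    hΦc ▸ cofCtblSubsets_le_of_isBasicFamily hw hD hcard hΦ
  by_cases h : ∃ n, DimLE K n
  · exact Or.inl ⟨h, h.choose_spec.basicCard_le hw |>.antisymm hcof⟩
  · have hdim := not_exists.1 h
    have hcont : 𝔠 ≤ basicCard K := hΦc ▸ continuum_le_of_isBasicFamily hdim hΦ
    have h1 : weightCard K ^ ℵ₀ ≤ basicCard K :=
      (power_aleph0_le_cofCtblSubsets_mul hw.le).trans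
        (mul_le_of_le (aleph0_le_continuum.trans hcont) hcof hcont)
    have h2 : basicCard K ≤ #C(K, ℝ) := (basicCard_le_mk isBasicFamily_univ).trans_eq mk_univ
    have h3 := mk_continuousMap_le_weightCard_power (X := K) hw.le
    exact Or.inr ⟨hdim, h2.antisymm (h3.trans h1), h3.antisymm (h1.trans h2)⟩

end
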